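/- If R' is an offensive alliance of G' with 1 ≤ |R'| ≤ r + 4n and R' ∩ V_□' = ∅, then R = R' ∩ V(G) is a strong offensive alliance of G with 1 ≤ |R| ≤ r, x ∈ R, and R ∩ V_□ = ∅. -/

import Mathlib

/-- The set of vertices outside `R` having at least one neighbour in `R`. -/
def nbhd {V : Type*} (G : SimpleGraph V) (R : Set V) : Set V :=
  {v | v ∉ R ∧ ∃ u ∈ R, G.Adj u v}

/-- The number of neighbours of `v` lying in `R`. -/
noncomputable def degIn {V : Type*} (G : SimpleGraph V) (R : Set V) (v : V) : ℕ :=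
  (G.neighborSet v ∩ R).ncard

/-- `R` is an offensive alliance: nonempty, and every vertex of `N(R)` has at least
one more neighbour inside `R` than outside `R`. -/
def IsOffensiveAlliance {V : Type*} (G : SimpleGraph V) (R : Set V) : Prop :=
  R.Nonempty ∧ ∀ v ∈ nbhd G R, degIn G Rᶜ v + 1 ≤ degIn G R v

/-- `R` is a strong offensive alliance. -/
def IsStrongOffensiveAlliance {V : Type*} (G : SimpleGraph V) (R : Set V) : Prop :=
  R.Nonempty ∧ ∀ v ∈ nbhd G R, degIn G Rᶜ v + 2 ≤ degIn G R v

/-- The new vertices added to `G`: `t^□`, `x^□`, the `4n` forbidden vertices of `V_t^□`,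
the `n` forbidden vertices of `V_x^□`, and the `4n` vertices of `T`. -/
inductive Gad (n : ℕ) : Type where
  | tsq : Gad n
  | xsq : Gad n
  | vt (p : Fin (4 * n)) : Gad n
  | vx (p : Fin n) : Gad n
  | tt (p : Fin (4 * n)) : Gad n

/-- One direction of each edge of `G'`: the edges of `G`; `t^□` joined to every vertex of
`V_t^□`; `x^□` joined to every vertex of `V_x^□`; every vertex of `T` joined to `t^□` and
`x^□`; `x^□` joined to every vertex of `V(G) ∖ F`; and the edge `(x, t^□)`. -/
def grel {V : Type*} (G : SimpleGraph V) (n : ℕ) (F : Set V) (x : V) :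
    V ⊕ Gad n → V ⊕ Gad n → Prop
  | Sum.inl a, Sum.inl b => G.Adj a b
  | Sum.inr Gad.tsq, Sum.inr (Gad.vt _) => True
  | Sum.inr Gad.xsq, Sum.inr (Gad.vx _) => True
  | Sum.inr (Gad.tt _), Sum.inr Gad.tsq => True
  | Sum.inr (Gad.tt _), Sum.inr Gad.xsq => True
  | Sum.inr Gad.xsq, Sum.inl v => v ∉ F
  | Sum.inl v, Sum.inr Gad.tsq => v = x
  | _, _ => False

/-- The set `T = {t_1, …, t_{4n}}`. -/
def Tset {V : Type*} (n : ℕ) : Set (V ⊕ Gad n) := {w | ∃ p, w = Sum.inr (Gad.tt p)}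

/-- The set `V_□' = V_□ ∪ V_t^□ ∪ V_x^□ ∪ {t^□, x^□}` of forbidden vertices of `G'`. -/
def VsqG' {V : Type*} (n : ℕ) (Vsq : Set V) : Set (V ⊕ Gad n) :=
  (Sum.inl '' Vsq) ∪ {w | ∃ p, w = Sum.inr (Gad.vt p)} ∪
    {w | ∃ p, w = Sum.inr (Gad.vx p)} ∪ {Sum.inr Gad.tsq, Sum.inr Gad.xsq}

instance Gad.instFinite (n : ℕ) : Finite (Gad n) := by
  let f : Bool ⊕ Fin (4 * n) ⊕ Fin n ⊕ Fin (4 * n) → Gad n := fun s => match s with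
    | .inl true => .tsq
    | .inl false => .xsq
    | .inr (.inl p) => .vt p
    | .inr (.inr (.inl p)) => .vx p
    | .inr (.inr (.inr p)) => .tt p
  refine Finite.of_surjective f fun g => ?_
  cases g with
  | tsq => exact ⟨.inl true, rfl⟩
  | xsq => exact ⟨.inl false, rfl⟩
  | vt p => exact ⟨.inr (.inl p), rfl⟩
  | vx p => exact ⟨.inr (.inr (.inl p)), rfl⟩
  | tt p => exact ⟨.inr (.inr (.inr p)), rfl⟩

theorem Tset_eq_range {V : Type*} (n : ℕ) :
    Tset n = Set.range fun p : Fin (4 * n) => (Sum.inr (Gad.tt p) : V ⊕ Gad n) := by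
  ext w
  simp [Tset, eq_comm]

theorem ncard_Tset {V : Type*} (n : ℕ) : (Tset n : Set (V ⊕ Gad n)).ncard = 4 * n := by
  rw [Tset_eq_range, Set.ncard_range_of_injective]
  · simp
  · intro p q h
    simpa using h

theorem IsOffensiveAlliance.lt_of_subset {W : Type*} [Finite W] {H : SimpleGraph W} {R : Set W}
    (hR : IsOffensiveAlliance H R) {v : W} (hv : v ∈ nbhd H R) {A B : Set W}
    (hA : A ⊆ H.neighborSet v ∩ Rᶜ) (hB : H.neighborSet v ∩ R ⊆ B) :
    A.ncard + 1 ≤ (H.neighborSet v ∩ R).ncard ∧ A.ncard + 1 ≤ B.ncard := by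
  have h := hR.2 v hv
  have hA' := Set.ncard_le_ncard hA
  have hB' := Set.ncard_le_ncard hB
  unfold degIn at h
  omega

section Gadget

variable {V : Type*} {G : SimpleGraph V} {n : ℕ} {F Vsq : Set V} {x : V} {R' : Set (V ⊕ Gad n)}

theorem inl_notMem_of_mem (hd : R' ∩ VsqG' n Vsq = ∅) {v : V} (hv : v ∈ Vsq) :
    Sum.inl v ∉ R' := fun h =>
  Set.eq_empty_iff_forall_notMem.1 hd _ ⟨h, by simp [VsqG', hv]⟩

theorem tsq_notMem (hd : R' ∩ VsqG' n Vsq = ∅) : Sum.inr Gad.tsq ∉ R' := fun h =>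
  Set.eq_empty_iff_forall_notMem.1 hd _ ⟨h, by simp [VsqG']⟩

theorem xsq_notMem (hd : R' ∩ VsqG' n Vsq = ∅) : Sum.inr Gad.xsq ∉ R' := fun h =>
  Set.eq_empty_iff_forall_notMem.1 hd _ ⟨h, by simp [VsqG']⟩

theorem vt_notMem (hd : R' ∩ VsqG' n Vsq = ∅) (p : Fin (4 * n)) :
    Sum.inr (Gad.vt p) ∉ R' := fun h =>
  Set.eq_empty_iff_forall_notMem.1 hd _ ⟨h, by simp [VsqG']⟩

theorem vx_notMem (hd : R' ∩ VsqG' n Vsq = ∅) (p : Fin n) :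
    Sum.inr (Gad.vx p) ∉ R' := fun h =>
  Set.eq_empty_iff_forall_notMem.1 hd _ ⟨h, by simp [VsqG']⟩

theorem Tset_subset_and_mem_of_tsq_mem_nbhd [Finite V] (hd : R' ∩ VsqG' n Vsq = ∅)
    (hR : IsOffensiveAlliance (SimpleGraph.fromRel (grel G n F x)) R')
    (ht : Sum.inr Gad.tsq ∈ nbhd (SimpleGraph.fromRel (grel G n F x)) R') :
    Tset n ⊆ R' ∧ Sum.inl x ∈ R' := by
  have hA : (Set.range fun p : Fin (4 * n) => (Sum.inr (Gad.vt p) : V ⊕ Gad n)) ⊆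
      (SimpleGraph.fromRel (grel G n F x)).neighborSet (Sum.inr Gad.tsq) ∩ R'ᶜ := by
    rintro _ ⟨p, rfl⟩
    exact ⟨by simp [grel], vt_notMem hd p⟩
  have hAc : (Set.range fun p : Fin (4 * n) => (Sum.inr (Gad.vt p) : V ⊕ Gad n)).ncard
      = 4 * n := by
    rw [Set.ncard_range_of_injective]
    · simp
    · intro p q h
      simpa using h
  have hB : (SimpleGraph.fromRel (grel G n F x)).neighborSet (Sum.inr Gad.tsq) ∩ R' ⊆
      insert (Sum.inl x) (Tset n) := by
    rintro (v | _ | _ | p | p | p) ⟨hadj, hmem⟩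
    · simp_all [grel]
    · simp at hadj
    · simp [grel] at hadj
    · exact absurd hmem (vt_notMem hd p)
    · simp [grel] at hadj
    · simp [Tset]
  have h := (hR.lt_of_subset ht hA hB).1
  have hT := Set.ncard_insert_le (Sum.inl x) (Tset n : Set (V ⊕ Gad n))
  rw [ncard_Tset] at hT
  have heq := Set.eq_of_subset_of_ncard_le hB (by omega)
  have hsub : insert (Sum.inl x) (Tset n) ⊆ R' := heq ▸ Set.inter_subset_right
  exact ⟨(Set.subset_insert _ _).trans hsub, hsub (Set.mem_insert _ _)⟩

theorem tsq_mem_nbhd [Fintype V] (hn : n = Fintype.card V) (hF : F ⊆ Vsq)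
    (hd : R' ∩ VsqG' n Vsq = ∅)
    (hR : IsOffensiveAlliance (SimpleGraph.fromRel (grel G n F x)) R') :
    Sum.inr Gad.tsq ∈ nbhd (SimpleGraph.fromRel (grel G n F x)) R' := by
  by_contra ht
  have hT : ∀ p, Sum.inr (Gad.tt p) ∉ R' := fun p hp =>
    ht ⟨tsq_notMem hd, _, hp, by simp [grel]⟩
  obtain ⟨v | _ | _ | p | p | p, hv⟩ := hR.1
  · have hx : Sum.inr Gad.xsq ∈ nbhd (SimpleGraph.fromRel (grel G n F x)) R' :=
      ⟨xsq_notMem hd, _, hv, by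
        simpa [grel] using fun h => inl_notMem_of_mem hd (hF h) hv⟩
    have hA : Tset n ⊆
        (SimpleGraph.fromRel (grel G n F x)).neighborSet (Sum.inr Gad.xsq) ∩ R'ᶜ := by
      rintro _ ⟨p, rfl⟩
      exact ⟨by simp [grel], hT p⟩
    have hB : (SimpleGraph.fromRel (grel G n F x)).neighborSet (Sum.inr Gad.xsq) ∩ R' ⊆
        Set.range Sum.inl := by
      rintro (v | _ | _ | p | p | p) ⟨hadj, hmem⟩
      · simp
      · simp [grel] at hadj
      · simp at hadj
      · simp [grel] at hadj
      · exact absurd hmem (vx_notMem hd p)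
      · exact absurd hmem (hT p)
    have h := (hR.lt_of_subset hx hA hB).2
    rw [ncard_Tset, Set.ncard_range_of_injective Sum.inl_injective, Nat.card_eq_fintype_card] at h
    omega
  · exact tsq_notMem hd hv
  · exact xsq_notMem hd hv
  · exact vt_notMem hd p hv
  · exact vx_notMem hd p hv
  · exact hT p hv

theorem degIn_compl_add_two_le [Finite V] (hd : R' ∩ VsqG' n Vsq = ∅)
    (hR : IsOffensiveAlliance (SimpleGraph.fromRel (grel G n F x)) R') {v : V} (hvF : v ∉ F)
    (hv : v ∈ nbhd G {v | Sum.inl v ∈ R'}) :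
    degIn G {v | Sum.inl v ∈ R'}ᶜ v + 2 ≤ degIn G {v | Sum.inl v ∈ R'} v := by
  obtain ⟨hvR, u, hu, huv⟩ := hv
  have hv' : Sum.inl v ∈ nbhd (SimpleGraph.fromRel (grel G n F x)) R' :=
    ⟨hvR, _, hu, by simpa [grel] using ⟨huv.ne, Or.inl huv⟩⟩
  have hA : insert (Sum.inr Gad.xsq) (Sum.inl '' (G.neighborSet v ∩ {v | Sum.inl v ∈ R'}ᶜ)) ⊆
      (SimpleGraph.fromRel (grel G n F x)).neighborSet (Sum.inl v) ∩ R'ᶜ := by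
    rintro _ (rfl | ⟨w, ⟨hw, hwR⟩, rfl⟩)
    · exact ⟨by simpa [grel] using hvF, xsq_notMem hd⟩
    · have hw' : G.Adj v w := hw
      exact ⟨by simpa [grel] using ⟨hw'.ne, Or.inl hw'⟩, hwR⟩
  have hB : (SimpleGraph.fromRel (grel G n F x)).neighborSet (Sum.inl v) ∩ R' ⊆
      Sum.inl '' (G.neighborSet v ∩ {v | Sum.inl v ∈ R'}) := by
    rintro (w | _ | _ | p | p | p) ⟨hadj, hmem⟩
    · refine ⟨w, ⟨?_, hmem⟩, rfl⟩
      simp only [SimpleGraph.mem_neighborSet, SimpleGraph.fromRel_adj, grel] at hadj ⊢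
      exact hadj.2.elim id SimpleGraph.Adj.symm
    · exact absurd hmem (tsq_notMem hd)
    · exact absurd hmem (xsq_notMem hd)
    · exact absurd hmem (vt_notMem hd p)
    · exact absurd hmem (vx_notMem hd p)
    · simp [grel] at hadj
  have h := (hR.lt_of_subset hv' hA hB).2
  rw [Set.ncard_insert_of_notMem (by simp), Set.ncard_image_of_injective _ Sum.inl_injective,
    Set.ncard_image_of_injective _ Sum.inl_injective] at h
  exact h

theorem ncard_inl_preimage_add_le [Finite V] (hT : Tset n ⊆ R') :
    Set.ncard {v | Sum.inl v ∈ R'} + 4 * n ≤ R'.ncard := by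
  rw [← Set.ncard_image_of_injective _ (Sum.inl_injective (α := V) (β := Gad n)),
    ← ncard_Tset (V := V) n, ← Set.ncard_union_eq]
  · refine Set.ncard_le_ncard (Set.union_subset ?_ hT)
    rintro _ ⟨v, hv, rfl⟩
    exact hv
  · rw [Set.disjoint_left]
    rintro _ ⟨v, -, rfl⟩ ⟨p, hp⟩
    simp at hp

end Gadget

theorem notMem_nbhd_of_leaf {V : Type*} {G : SimpleGraph V} {R : Set V} {v w : V}
    (h1 : (G.neighborSet v).ncard = 1) (hvw : G.Adj v w) (hw : w ∉ R) : v ∉ nbhd G R := by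
  rintro ⟨-, u, hu, huv⟩
  obtain ⟨a, ha⟩ := Set.ncard_eq_one.1 h1
  have hwa : w ∈ ({a} : Set V) := ha ▸ hvw
  have hua : u ∈ ({a} : Set V) := ha ▸ huv.symm
  exact hw (Set.mem_singleton_iff.1 hwa ▸ Set.mem_singleton_iff.1 hua ▸ hu)

theorem stmt9 {V : Type*} [Fintype V] (G : SimpleGraph V) (r : ℕ) (hr : 1 ≤ r)
    (Vsq : Set V) (x : V) (hx : x ∉ Vsq)
    (hdeg1 : ∀ v ∈ Vsq, (G.neighborSet v).ncard = 1 → ∃ w ∈ Vsq, G.Adj v w)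
    (hdeg2 : ∀ v ∈ Vsq, 1 < (G.neighborSet v).ncard →
      ∃ w ∈ Vsq, (G.neighborSet w).ncard = 1 ∧ G.Adj v w) :
    let n := Fintype.card V
    let F : Set V := {v | v ∈ Vsq ∧ (G.neighborSet v).ncard = 1}
    let G' : SimpleGraph (V ⊕ Gad n) := SimpleGraph.fromRel (grel G n F x)
    ∀ R' : Set (V ⊕ Gad n), IsOffensiveAlliance G' R' →
      1 ≤ R'.ncard → R'.ncard ≤ r + 4 * n → R' ∩ VsqG' n Vsq = ∅ →
      IsStrongOffensiveAlliance G {v | Sum.inl v ∈ R'} ∧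
        1 ≤ Set.ncard {v | Sum.inl v ∈ R'} ∧ Set.ncard {v | Sum.inl v ∈ R'} ≤ r ∧
        x ∈ {v | Sum.inl v ∈ R'} ∧ {v | Sum.inl v ∈ R'} ∩ Vsq = ∅ := by
  intro n F G' R' hR _ hcard hd
  obtain ⟨hT, hxR⟩ := Tset_subset_and_mem_of_tsq_mem_nbhd hd hR
    (tsq_mem_nbhd rfl (fun _ h => h.1) hd hR)
  refine ⟨⟨⟨x, hxR⟩, fun v hv => degIn_compl_add_two_le hd hR ?_ hv⟩,
    (Set.ncard_pos (Set.toFinite _)).2 ⟨x, hxR⟩, ?_, hxR, ?_⟩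
  · rintro ⟨hvV, h1⟩
    obtain ⟨w, hw, hvw⟩ := hdeg1 v hvV h1
    exact notMem_nbhd_of_leaf h1 hvw (inl_notMem_of_mem hd hw) hv
  · have := ncard_inl_preimage_add_le hT
    omega
  · exact Set.eq_empty_iff_forall_notMem.2 fun v hv => inl_notMem_of_mem hd hv.2 hv.1
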